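/- Fix integers r ≥ 1 and l ≥ 1. For every real ε > 0 there exists N such that for all integers n_1, ..., n_r with 1 < n_1 | n_2 | ... | n_r, ω(n_r) = l and P^-(n_r) ≥ N, the group G = C_{n_1} ⊕ ... ⊕ C_{n_r} satisfies k(G) ≤ rl + ε, K(G) ≤ rl + ε, and D(G) ≤ (rl + ε)·n_r. -/

import Mathlib

open scoped BigOperators

attribute [local instance] Classical.propDecidable

/-- A sequence (multiset) over `G` is zero-sumfree if no nonempty sub-multiset sums to `0`. -/
def IsZeroSumFree {G : Type*} [AddCommGroup G] (S : Multiset G) : Prop :=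
  ∀ T : Multiset G, T ≤ S → T ≠ 0 → T.sum ≠ 0

/-- A minimal zero-sum sequence: sum `0`, and no nonempty proper sub-multiset sums to `0`. -/
def IsMinimalZeroSum {G : Type*} [AddCommGroup G] (S : Multiset G) : Prop :=
  S.sum = 0 ∧ ∀ T : Multiset G, T < S → T ≠ 0 → T.sum ≠ 0

/-- The cross number of a sequence: `k(S) = Σ_{g ∈ S} 1/ord(g)`. -/
noncomputable def crossNumber {G : Type*} [AddCommGroup G] (S : Multiset G) : ℝ :=
  (S.map fun g => (1 : ℝ) / (addOrderOf g)).sum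

/-- The little cross number `k(G)`: max of `k(S)` over zero-sumfree sequences `S` over `G`. -/
noncomputable def littleCrossNumber (G : Type*) [AddCommGroup G] : ℝ :=
  sSup {x : ℝ | ∃ S : Multiset G, IsZeroSumFree S ∧ crossNumber S = x}

/-- The cross number `K(G)`: max of `k(S)` over minimal zero-sum sequences `S` over `G`. -/
noncomputable def bigCrossNumber (G : Type*) [AddCommGroup G] : ℝ :=
  sSup {x : ℝ | ∃ S : Multiset G, IsMinimalZeroSum S ∧ crossNumber S = x}

/-- The Davenport constant `D(G)`. -/
noncomputable def davenport (G : Type*) [AddCommGroup G] : ℕ :=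
  sInf {t | 1 ≤ t ∧ ∀ S : Multiset G, t ≤ Multiset.card S →
    ∃ T, T ≤ S ∧ T ≠ 0 ∧ T.sum = 0}

/-- The constant `η(G)`. -/
noncomputable def etaConst (G : Type*) [AddCommGroup G] : ℕ :=
  sInf {t | 1 ≤ t ∧ ∀ S : Multiset G, t ≤ Multiset.card S →
    ∃ T, T ≤ S ∧ T ≠ 0 ∧ Multiset.card T ≤ AddMonoid.exponent G ∧ T.sum = 0}

/-- `υ_i(d',d) = A_i / gcd(A_i, B_i)` where `A_i = gcd(d', n_i)` and
`B_i = lcm(d, n_i)/lcm(d', n_i)`. -/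
def upsilon (ni d' d : ℕ) : ℕ :=
  Nat.gcd d' ni / Nat.gcd (Nat.gcd d' ni) (Nat.lcm d ni / Nat.lcm d' ni)

/-- `k*` of `C_{n_1} ⊕ ... ⊕ C_{n_r}`, computed from the primary decomposition. -/
noncomputable def kStarTuple {r : ℕ} (n : Fin r → ℕ) : ℝ :=
  ∑ i, ∑ p ∈ (n i).primeFactors,
    ((p ^ ((n i).factorization p) : ℝ) - 1) / (p ^ ((n i).factorization p))

/-- `α(n) = Σ_{d | n} (P⁻(d) − 1)/d`. -/
noncomputable def alphaFn (n : ℕ) : ℝ :=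
  ∑ d ∈ n.divisors, ((d.minFac : ℝ) - 1) / d

/-- `β(n) = Σ_{p | n prime} (p − 1)/p`. -/
noncomputable def betaFn (n : ℕ) : ℝ :=
  ∑ p ∈ n.primeFactors, ((p : ℝ) - 1) / p

/-- The number of `y ∈ Y` with `y + x ∈ Y`. -/
noncomputable def overlap {G : Type*} [AddCommGroup G] (Y : Finset G) (x : G) : ℕ :=
  (Y.filter fun y => y + x ∈ Y).card

theorem overlap_mul_card_eq {G : Type*} [AddCommGroup G] [Fintype G] (Y : Finset G) (x : G) :
    (overlap Y x : ℂ) * Fintype.card G =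
      ∑ χ : AddChar G ℂ, (Complex.normSq (∑ y ∈ Y, χ y) : ℂ) * χ x := by
  have h1 : ∀ χ : AddChar G ℂ, (Complex.normSq (∑ y ∈ Y, χ y) : ℂ) * χ x =
      ∑ y ∈ Y, ∑ z ∈ Y, χ (y + x - z) := by
    intro χ
    rw [← Complex.mul_conj, map_sum, Finset.sum_mul_sum, Finset.sum_mul]
    refine Finset.sum_congr rfl fun y _ => ?_
    rw [Finset.sum_mul]
    refine Finset.sum_congr rfl fun z _ => ?_
    rw [← AddChar.map_neg_eq_conj, ← AddChar.map_add_eq_mul, ← AddChar.map_add_eq_mul]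
    congr 1
    abel
  simp_rw [h1]
  rw [Finset.sum_comm]
  have h2 : ∀ y ∈ Y, ∑ χ : AddChar G ℂ, ∑ z ∈ Y, χ (y + x - z) =
      if y + x ∈ Y then (Fintype.card G : ℂ) else 0 := by
    intro y _
    rw [Finset.sum_comm]
    simp_rw [AddChar.sum_apply_eq_ite, sub_eq_zero]
    simp
  rw [Finset.sum_congr rfl h2, ← Finset.sum_filter, Finset.sum_const, overlap, nsmul_eq_mul]

theorem sum_normSq_addChar {G : Type*} [AddCommGroup G] [Fintype G] (Y : Finset G) :
    ∑ χ : AddChar G ℂ, Complex.normSq (∑ y ∈ Y, χ y) = Y.card * Fintype.card G := by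
  have h := overlap_mul_card_eq Y 0
  have h0 : overlap Y 0 = Y.card := by simp [overlap]
  rw [h0] at h
  simp only [AddChar.map_zero_eq_one, mul_one] at h
  exact_mod_cast h.symm

theorem sum_overlap_le {G ι : Type*} [AddCommGroup G] [Fintype G] (I : Finset ι) (x : ι → G)
    (Y : Finset G) (h : ∀ χ : AddChar G ℂ, χ ≠ 1 → (∑ i ∈ I, χ (x i)).re ≤ I.card / 2) :
    (∑ i ∈ I, (overlap Y (x i) : ℝ)) * Fintype.card G ≤
      I.card * ((Y.card : ℝ) ^ 2 + Fintype.card G * Y.card) / 2 := by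
  have h1 : (∑ i ∈ I, (overlap Y (x i) : ℝ)) * Fintype.card G =
      ∑ χ : AddChar G ℂ, Complex.normSq (∑ y ∈ Y, χ y) * (∑ i ∈ I, χ (x i)).re := by
    have : (∑ i ∈ I, (overlap Y (x i) : ℂ)) * Fintype.card G =
        ∑ χ : AddChar G ℂ, (Complex.normSq (∑ y ∈ Y, χ y) : ℂ) * ∑ i ∈ I, χ (x i) := by
      rw [Finset.sum_mul]
      simp_rw [overlap_mul_card_eq, Finset.mul_sum]
      rw [Finset.sum_comm]
    have h2 := congrArg Complex.re this
    rw [Complex.re_sum] at h2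
    simp_rw [Complex.re_ofReal_mul] at h2
    rw [← h2]
    norm_cast
  have h3 := sum_normSq_addChar Y
  rw [h1, ← Finset.add_sum_erase _ _ (Finset.mem_univ (1 : AddChar G ℂ))]
  rw [← Finset.add_sum_erase _ _ (Finset.mem_univ (1 : AddChar G ℂ))] at h3
  have h4 : ∑ χ ∈ Finset.univ.erase (1 : AddChar G ℂ),
      Complex.normSq (∑ y ∈ Y, χ y) * (∑ i ∈ I, χ (x i)).re ≤
      ∑ χ ∈ Finset.univ.erase (1 : AddChar G ℂ),
        Complex.normSq (∑ y ∈ Y, χ y) * (I.card / 2) :=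
    Finset.sum_le_sum fun χ hχ => mul_le_mul_of_nonneg_left
      (h χ (Finset.ne_of_mem_erase hχ)) (Complex.normSq_nonneg _)
  rw [← Finset.sum_mul] at h4
  have h5 : Complex.normSq (∑ y ∈ Y, (1 : AddChar G ℂ) y) = (Y.card : ℝ) ^ 2 := by
    simp [sq]
  have h6 : (∑ i ∈ I, (1 : AddChar G ℂ) (x i)).re = I.card := by simp
  rw [h5] at h3 ⊢
  rw [h6]
  have h7 := eq_sub_of_add_eq' h3
  rw [h7] at h4
  linarith

theorem overlap_add_overlap_le {G : Type*} [AddCommGroup G] (Y : Finset G) (x z : G) :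
    overlap Y x + overlap Y z ≤ overlap Y (x + z) + Y.card := by
  have hx : overlap Y x = ((Y.filter fun y => y + x ∈ Y).image fun y => y + x).card :=
    (Finset.card_image_of_injective _ (add_left_injective x)).symm
  have hxz : (((Y.filter fun y => y + x ∈ Y).image fun y => y + x) ∩
      Y.filter fun y => y + z ∈ Y).card ≤ overlap Y (x + z) := by
    refine (Finset.card_le_card (t := (Y.filter fun y => y + (x + z) ∈ Y).image fun y => y + x)
      ?_).trans Finset.card_image_le
    intro w hw
    simp only [Finset.mem_inter, Finset.mem_image, Finset.mem_filter] at hw ⊢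
    obtain ⟨⟨y, ⟨hy, _⟩, rfl⟩, _, h⟩ := hw
    exact ⟨y, ⟨hy, by rwa [← add_assoc]⟩, rfl⟩
  have hu : (((Y.filter fun y => y + x ∈ Y).image fun y => y + x) ∪
      Y.filter fun y => y + z ∈ Y).card ≤ Y.card := by
    refine Finset.card_le_card fun w hw => ?_
    simp only [Finset.mem_union, Finset.mem_image, Finset.mem_filter] at hw
    rcases hw with ⟨y, ⟨_, h⟩, rfl⟩ | h
    exacts [h, h.1]
  have := Finset.card_union_add_card_inter
    ((Y.filter fun y => y + x ∈ Y).image fun y => y + x) (Y.filter fun y => y + z ∈ Y)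
  rw [hx]
  have hz : overlap Y z = (Y.filter fun y => y + z ∈ Y).card := rfl
  omega

theorem overlap_nsmul_le {G : Type*} [AddCommGroup G] (Y : Finset G) (x : G) (j : ℕ) :
    Y.card + j * overlap Y x ≤ overlap Y (j • x) + j * Y.card := by
  induction j with
  | zero => simp [overlap]
  | succ j ih =>
    have := overlap_add_overlap_le Y (j • x) x
    rw [succ_nsmul]
    linarith

theorem sum_normSq_geom_nthRoots {p : ℕ} (hp : p.Prime) {J : ℕ} (hJ : J ≤ p) :
    ∑ ζ ∈ Polynomial.nthRootsFinset p (1 : ℂ), Complex.normSq (∑ j ∈ Finset.range J, ζ ^ j) =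
      p * J := by
  have hω := Complex.isPrimitiveRoot_exp p hp.ne_zero
  set ω := Complex.exp (2 * Real.pi * Complex.I / p) with hωdef
  have hmem : ∀ ζ : ℂ, ζ ∈ Polynomial.nthRootsFinset p (1 : ℂ) ↔ ζ ^ p = 1 := fun ζ =>
    Polynomial.mem_nthRootsFinset hp.pos 1
  have himg : Polynomial.nthRootsFinset p (1 : ℂ) = (Finset.range p).image fun k => ω ^ k := by
    ext ζ
    rw [hmem, Finset.mem_image]
    constructor
    · intro h
      have : NeZero p := ⟨hp.ne_zero⟩
      obtain ⟨i, hi, h⟩ := hω.eq_pow_of_pow_eq_one h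
      exact ⟨i, Finset.mem_range.2 hi, h⟩
    · rintro ⟨i, _, rfl⟩
      rw [← pow_mul, mul_comm, pow_mul, hω.pow_eq_one, one_pow]
  have hω1 : ‖ω‖ = 1 := Complex.norm_eq_one_of_pow_eq_one hω.pow_eq_one hp.ne_zero
  have hω0 : ω ≠ 0 := hω.ne_zero hp.ne_zero
  have hconj : (starRingEnd ℂ) ω = ω⁻¹ := (Complex.inv_eq_conj hω1).symm
  have key : ∑ ζ ∈ Polynomial.nthRootsFinset p (1 : ℂ),
      (Complex.normSq (∑ j ∈ Finset.range J, ζ ^ j) : ℂ) = p * J := by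
    rw [himg, Finset.sum_image]
    · have h1 : ∀ k, (Complex.normSq (∑ j ∈ Finset.range J, (ω ^ k) ^ j) : ℂ) =
          ∑ i ∈ Finset.range J, ∑ j ∈ Finset.range J, (ω ^ i * (ω ^ j)⁻¹) ^ k := by
        intro k
        rw [← Complex.mul_conj, map_sum, Finset.sum_mul_sum]
        refine Finset.sum_congr rfl fun i _ => Finset.sum_congr rfl fun j _ => ?_
        rw [map_pow, map_pow, hconj, mul_pow, inv_pow, inv_pow, inv_pow, ← pow_mul, ← pow_mul,
          ← pow_mul, ← pow_mul, mul_comm k i, mul_comm k j]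
      simp_rw [h1]
      rw [Finset.sum_comm]
      have h2 : ∀ i ∈ Finset.range J, ∑ k ∈ Finset.range p, ∑ j ∈ Finset.range J,
          (ω ^ i * (ω ^ j)⁻¹) ^ k = p := by
        intro i hi
        rw [Finset.sum_comm, Finset.sum_eq_single_of_mem i hi]
        · simp [mul_inv_cancel₀ (pow_ne_zero i hω0)]
        · intro j hj hji
          have hne : ω ^ i * (ω ^ j)⁻¹ ≠ 1 := by
            intro h
            rw [mul_inv_eq_one₀ (pow_ne_zero _ hω0)] at h
            exact hji (hω.pow_inj ((Finset.mem_range.1 hi).trans_le hJ)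
              ((Finset.mem_range.1 hj).trans_le hJ) h).symm
          have h3 := mul_geom_sum (ω ^ i * (ω ^ j)⁻¹) p
          have h4 : (ω ^ i * (ω ^ j)⁻¹) ^ p = 1 := by
            rw [mul_pow, inv_pow, ← pow_mul, ← pow_mul, mul_comm i, mul_comm j, pow_mul, pow_mul,
              hω.pow_eq_one]
            simp
          rw [h4, sub_self] at h3
          exact (mul_eq_zero.1 h3).resolve_left (sub_ne_zero.2 hne)
      rw [Finset.sum_congr rfl h2]
      simp [mul_comm]
    · intro i hi j hj h
      exact hω.pow_inj (Finset.mem_range.1 hi) (Finset.mem_range.1 hj) h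
  exact_mod_cast key

theorem re_sum_addChar_le {G ι : Type*} [AddCommGroup G] {p : ℕ} (hp : p.Prime)
    (hG : ∀ x : G, p • x = 0) (χ : AddChar G ℂ) {J m : ℕ} (hJ : J ≤ p) (hJ0 : 0 < J)
    (B : Finset ι) (s : ι → G) (a : G) (hm : ∀ ζ, (B.filter fun i => χ (s i) = ζ).card ≤ m)
    (hmB : 4 * (m * p) ≤ B.card * J) :
    (∑ bj ∈ B ×ˢ Finset.range J, χ (bj.2 • (s bj.1 - a))).re ≤ ((B ×ˢ Finset.range J).card : ℝ) / 2 := by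
  have hJR : (0 : ℝ) < J := by exact_mod_cast hJ0
  have hone : ∀ x : G, χ x ^ p = 1 := fun x => by
    rw [← AddChar.map_nsmul_eq_pow, hG, AddChar.map_zero_eq_one]
  have ha : χ a ≠ 0 := fun h => by simpa [h, hp.ne_zero] using hone a
  have hfib : ∑ b ∈ B, Complex.normSq (∑ j ∈ Finset.range J, χ (s b - a) ^ j) ≤ m * (p * J) := by
    rw [← sum_normSq_geom_nthRoots hp hJ, Finset.mul_sum]
    rw [← Finset.sum_fiberwise_of_maps_to (t := Polynomial.nthRootsFinset p (1 : ℂ))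
      (g := fun b => χ (s b - a)) fun b _ => (Polynomial.mem_nthRootsFinset hp.pos 1).2 (hone _)]
    refine Finset.sum_le_sum fun ζ _ => ?_
    rw [Finset.sum_congr rfl (g := fun _ => Complex.normSq (∑ j ∈ Finset.range J, ζ ^ j))
      fun b hb => by rw [(Finset.mem_filter.1 hb).2], Finset.sum_const, nsmul_eq_mul]
    refine mul_le_mul_of_nonneg_right ?_ (Complex.normSq_nonneg _)
    have : (B.filter fun b => χ (s b - a) = ζ) = B.filter fun b => χ (s b) = ζ * χ a := by
      refine Finset.filter_congr fun b _ => ?_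
      have h : χ (s b) = χ (s b - a) * χ a := by
        rw [← AddChar.map_add_eq_mul, sub_add_cancel]
      rw [h, mul_left_inj' ha]
    rw [this]
    exact_mod_cast hm _
  have hre : ∀ z : ℂ, z.re ≤ Complex.normSq z / J + J / 4 := by
    intro z
    have h1 : z.re * z.re ≤ Complex.normSq z := Complex.re_sq_le_normSq z
    have h2 : z.re ≤ z.re * z.re / J + J / 4 := by
      rw [← sub_nonneg]
      have : z.re * z.re / J + J / 4 - z.re = (z.re - J / 2) ^ 2 / J := by
        field_simp
        ring
      rw [this]
      positivity
    have h3 : z.re * z.re / J ≤ Complex.normSq z / J := by gcongr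
    linarith
  rw [Finset.sum_product, Complex.re_sum]
  simp_rw [AddChar.map_nsmul_eq_pow]
  calc _ ≤ ∑ b ∈ B, (Complex.normSq (∑ j ∈ Finset.range J, χ (s b - a) ^ j) / J + (J : ℝ) / 4) :=
        Finset.sum_le_sum fun b _ => hre _
    _ ≤ m * (p * J) / J + B.card * (J / 4) := by
        rw [Finset.sum_add_distrib, ← Finset.sum_div, Finset.sum_const, nsmul_eq_mul]
        gcongr
    _ ≤ _ := by
        have : (4 * (m * p) : ℝ) ≤ B.card * J := by exact_mod_cast hmB
        rw [Finset.card_product, Finset.card_range, Nat.cast_mul, ← mul_assoc,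
          mul_div_cancel_right₀ _ hJR.ne']
        linarith

theorem exists_overlap_le {G ι : Type*} [AddCommGroup G] [Fintype G] {p : ℕ} (hp : p.Prime)
    (hG : ∀ x : G, p • x = 0) {J m : ℕ} (hJ : J ≤ p) (hJ0 : 0 < J)
    (B : Finset ι) (hB : B.Nonempty) (s : ι → G) (a : G)
    (hm : ∀ χ : AddChar G ℂ, χ ≠ 1 → ∀ ζ, (B.filter fun i => χ (s i) = ζ).card ≤ m)
    (hmB : 4 * (m * p) ≤ B.card * J) (Y : Finset G) (hY : 2 * Y.card ≤ Fintype.card G) :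
    ∃ b ∈ B, Y.card + 4 * J * overlap Y (s b - a) ≤ 4 * J * Y.card := by
  by_contra! hcon
  have h1 := sum_overlap_le (B ×ˢ Finset.range J) (fun bj => bj.2 • (s bj.1 - a)) Y
    fun χ hχ => re_sum_addChar_le hp hG χ hJ hJ0 B s a (hm χ hχ) hmB
  have hGpos : (0 : ℝ) < Fintype.card G := by exact_mod_cast Fintype.card_pos
  have h2 : ∀ bj ∈ B ×ˢ Finset.range J, (3 / 4 : ℝ) * Y.card <
      overlap Y (bj.2 • (s bj.1 - a)) := by
    intro bj hbj
    rw [Finset.mem_product, Finset.mem_range] at hbj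
    have h3 := hcon _ hbj.1
    have h4 := overlap_nsmul_le Y (s bj.1 - a) bj.2
    have h5 : overlap Y (s bj.1 - a) ≤ Y.card := Finset.card_filter_le _ _
    have h3' : (4 * J * Y.card : ℝ) < Y.card + 4 * J * overlap Y (s bj.1 - a) := by
      exact_mod_cast h3
    have h4' : (Y.card + bj.2 * overlap Y (s bj.1 - a) : ℝ) ≤
      overlap Y (bj.2 • (s bj.1 - a)) + bj.2 * Y.card := by exact_mod_cast h4
    have h5' : (overlap Y (s bj.1 - a) : ℝ) ≤ Y.card := by exact_mod_cast h5
    have h6 : (bj.2 : ℝ) ≤ J := by exact_mod_cast hbj.2.le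
    nlinarith [mul_le_mul_of_nonneg_right h6 (sub_nonneg.2 h5')]
  have hne : (B ×ˢ Finset.range J).Nonempty := hB.product (by simpa using hJ0.ne')
  have h3 := Finset.sum_lt_sum_of_nonempty hne h2
  rw [Finset.sum_const, nsmul_eq_mul] at h3
  have hYR : (2 * Y.card : ℝ) ≤ Fintype.card G := by exact_mod_cast hY
  have h4 := (mul_lt_mul_of_pos_right h3 hGpos).trans_le h1
  have h5 : (0 : ℝ) < (B ×ˢ Finset.range J).card := by exact_mod_cast hne.card_pos
  have h6 : (0 : ℝ) ≤ Y.card := by positivity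
  have h7 : ((B ×ˢ Finset.range J).card : ℝ) * (3 / 4 * Y.card) * Fintype.card G <
    (B ×ˢ Finset.range J).card * (3 / 4 * Y.card * Fintype.card G) := by
    refine h4.trans_le ?_
    rw [mul_div_assoc]
    gcongr
    nlinarith
  linarith

theorem card_image_union_image_add_overlap {G : Type*} [AddCommGroup G] (Y : Finset G) (a b : G) :
    (Y.image (· + a) ∪ Y.image (· + b)).card + overlap Y (b - a) = 2 * Y.card := by
  have h := Finset.card_union_add_card_inter (Y.image (· + a)) (Y.image (· + b))
  rw [Finset.card_image_of_injective _ (add_left_injective a),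
    Finset.card_image_of_injective _ (add_left_injective b)] at h
  have h2 : Y.image (· + a) ∩ Y.image (· + b) =
      (Y.filter fun y => y + (b - a) ∈ Y).image (· + b) := by
    ext w
    simp only [Finset.mem_inter, Finset.mem_image, Finset.mem_filter]
    constructor
    · rintro ⟨⟨y, hy, hyw⟩, z, hz, rfl⟩
      refine ⟨z, ⟨hz, ?_⟩, rfl⟩
      have : z + (b - a) = y := by rw [← add_sub_assoc, ← hyw, add_sub_cancel_right]
      rwa [this]
    · rintro ⟨z, ⟨hz, hz'⟩, rfl⟩
      exact ⟨⟨_, hz', by abel⟩, z, hz, rfl⟩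
  rw [h2, Finset.card_image_of_injective _ (add_left_injective b)] at h
  rw [overlap]
  omega

theorem exists_growing_sumset {G ι : Type*} [AddCommGroup G] [Fintype G] {p : ℕ} (hp : p.Prime)
    (hG : ∀ x : G, p • x = 0) {J m M : ℕ} (hJ : J ≤ p) (hJ0 : 0 < J) (hM : 1 ≤ M)
    (hmM : 4 * (m * p) ≤ M * J) (s : ι → G) (B : Finset ι)
    (hm : ∀ χ : AddChar G ℂ, χ ≠ 1 → ∀ ζ, (B.filter fun i => χ (s i) = ζ).card ≤ m)
    (k : ℕ) (hB : M + 2 * k ≤ B.card) :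
    ∃ U ⊆ B, U.card = 2 * k ∧ ∃ Y : Finset G,
      (∀ y ∈ Y, ∃ T ⊆ U, T.card = k ∧ ∑ i ∈ T, s i = y) ∧
      (Fintype.card G < 2 * Y.card ∨ (4 * J + 1) ^ k ≤ Y.card * (4 * J) ^ k) := by
  induction k with
  | zero =>
    refine ⟨∅, by simp, by simp, {0}, ?_, Or.inr (by simp)⟩
    simp
  | succ k ih =>
    obtain ⟨U, hUB, hU, Y, hY, hgrow⟩ := ih (by omega)
    have hc : (B \ U).card = B.card - 2 * k := by rw [Finset.card_sdiff_of_subset hUB, hU]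
    obtain ⟨a, ha⟩ : (B \ U).Nonempty := by
      rw [← Finset.card_pos]
      omega
    have hc' : ((B \ U).erase a).card = B.card - 2 * k - 1 := by
      rw [Finset.card_erase_of_mem ha, hc]
    have hsub : (B \ U).erase a ⊆ B := (Finset.erase_subset _ _).trans Finset.sdiff_subset
    have hne : ((B \ U).erase a).Nonempty := by
      rw [← Finset.card_pos]
      omega
    have hb : ∃ b ∈ (B \ U).erase a, Fintype.card G < 2 * Y.card ∨
        Y.card + 4 * J * overlap Y (s b - s a) ≤ 4 * J * Y.card := by
      by_cases hYG : Fintype.card G < 2 * Y.card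
      · obtain ⟨b, hb⟩ := hne
        exact ⟨b, hb, Or.inl hYG⟩
      · obtain ⟨b, hb, h⟩ := exists_overlap_le hp hG hJ hJ0 ((B \ U).erase a) hne s (s a)
          (fun χ hχ ζ => (Finset.card_le_card (Finset.filter_subset_filter _ hsub)).trans
            (hm χ hχ ζ)) (hmM.trans (Nat.mul_le_mul_right _ (by omega))) Y (by omega)
        exact ⟨b, hb, Or.inr h⟩
    obtain ⟨b, hb, hbY⟩ := hb
    have hba : b ≠ a := Finset.ne_of_mem_erase hb
    have hb' := Finset.mem_sdiff.1 (Finset.mem_of_mem_erase hb)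
    have ha' := Finset.mem_sdiff.1 ha
    refine ⟨insert a (insert b U), ?_, ?_, Y.image (· + s a) ∪ Y.image (· + s b), ?_, ?_⟩
    · exact Finset.insert_subset ha'.1 (Finset.insert_subset hb'.1 hUB)
    · rw [Finset.card_insert_of_notMem, Finset.card_insert_of_notMem hb'.2, hU]
      · ring
      · simp [hba.symm, ha'.2]
    · intro w hw
      have hext : ∀ c ∈ insert a (insert b U), c ∉ U → ∀ y ∈ Y,
          ∃ T ⊆ insert a (insert b U), T.card = k + 1 ∧ ∑ i ∈ T, s i = y + s c := by
        intro c hc hcU y hy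
        obtain ⟨T, hT, hTc, rfl⟩ := hY y hy
        have hcT : c ∉ T := fun h => hcU (hT h)
        refine ⟨insert c T, Finset.insert_subset hc ?_, ?_, ?_⟩
        · exact hT.trans ((Finset.subset_insert _ _).trans (Finset.subset_insert _ _))
        · rw [Finset.card_insert_of_notMem hcT, hTc]
        · rw [Finset.sum_insert hcT, add_comm]
      rw [Finset.mem_union, Finset.mem_image, Finset.mem_image] at hw
      rcases hw with ⟨y, hy, rfl⟩ | ⟨y, hy, rfl⟩
      · exact hext a (by simp) ha'.2 y hy
      · exact hext b (by simp) hb'.2 y hy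
    · have hle : Y.card ≤ (Y.image (· + s a) ∪ Y.image (· + s b)).card := by
        rw [← Finset.card_image_of_injective Y (add_left_injective (s a))]
        exact Finset.card_le_card Finset.subset_union_left
      by_cases hYG : Fintype.card G < 2 * Y.card
      · left
        omega
      · right
        have h1 := hgrow.resolve_left hYG
        have h2 := hbY.resolve_left hYG
        have h3 := card_image_union_image_add_overlap Y (s a) (s b)
        set Z := Y.image (· + s a) ∪ Y.image (· + s b)
        have h4 : (4 * J + 1) * Y.card ≤ 4 * J * Z.card := by
          have : 4 * J * (Z.card + overlap Y (s b - s a)) = 4 * J * (2 * Y.card) := by rw [h3]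
          nlinarith
        calc (4 * J + 1) ^ (k + 1) = (4 * J + 1) ^ k * (4 * J + 1) := pow_succ _ _
          _ ≤ Y.card * (4 * J) ^ k * (4 * J + 1) := Nat.mul_le_mul_right _ h1
          _ = (4 * J + 1) * Y.card * (4 * J) ^ k := by ring
          _ ≤ 4 * J * Z.card * (4 * J) ^ k := Nat.mul_le_mul_right _ h4
          _ = Z.card * (4 * J) ^ (k + 1) := by ring

theorem exists_zero_sum_of_not_concentrated {G ι : Type*} [AddCommGroup G] [Fintype G] {p : ℕ}
    (hp : p.Prime) (hG : ∀ x : G, p • x = 0) {J m M : ℕ} (hJ : J ≤ p) (hJ0 : 0 < J) (hM : 1 ≤ M)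
    (hmM : 4 * (m * p) ≤ M * J)
    (hgrow : Fintype.card G * (4 * J) ^ (p / 2) ≤ (4 * J + 1) ^ (p / 2))
    (s : ι → G) (I : Finset ι)
    (hm : ∀ χ : AddChar G ℂ, χ ≠ 1 → ∀ ζ, (I.filter fun i => χ (s i) = ζ).card ≤ m)
    (hI : M + 2 * p ≤ I.card) :
    ∃ T ⊆ I, T.card = p ∧ ∑ i ∈ T, s i = 0 := by
  have hpos : 0 < (4 * J) ^ (p / 2) := by positivity
  have hlarge : ∀ Y : Finset G, (Fintype.card G < 2 * Y.card ∨
      (4 * J + 1) ^ (p / 2) ≤ Y.card * (4 * J) ^ (p / 2)) → Fintype.card G < 2 * Y.card := by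
    rintro Y (h | h)
    · exact h
    · have h1 := Nat.le_of_mul_le_mul_right (hgrow.trans h) hpos
      have : 0 < Fintype.card G := Fintype.card_pos
      omega
  obtain ⟨U, hUI, hU, Y, hY, hYG⟩ := exists_growing_sumset hp hG hJ hJ0 hM hmM s I hm (p / 2)
    (by omega)
  have hc : (I \ U).card = I.card - 2 * (p / 2) := by rw [Finset.card_sdiff_of_subset hUI, hU]
  obtain ⟨V, hVI, hV, Z, hZ, hZG⟩ := exists_growing_sumset hp hG hJ hJ0 hM hmM s (I \ U)
    (fun χ hχ ζ => (Finset.card_le_card (Finset.filter_subset_filter _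
      Finset.sdiff_subset)).trans (hm χ hχ ζ)) (p / 2) (by omega)
  have hc' : ((I \ U) \ V).card = I.card - 2 * (p / 2) - 2 * (p / 2) := by
    rw [Finset.card_sdiff_of_subset hVI, hc, hV]
  obtain ⟨R, hR, hRc⟩ := Finset.exists_subset_card_eq
    (show p - 2 * (p / 2) ≤ ((I \ U) \ V).card by omega)
  have hYG := hlarge Y hYG
  have hZG := hlarge Z hZG
  obtain ⟨y, hy⟩ : (Y ∩ Z.image fun z => -(∑ i ∈ R, s i) - z).Nonempty := by
    refine Finset.inter_nonempty_of_card_lt_card_add_card (Finset.subset_univ _)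
      (Finset.subset_univ _) ?_
    rw [Finset.card_image_of_injective _ sub_right_injective, Finset.card_univ]
    omega
  rw [Finset.mem_inter, Finset.mem_image] at hy
  obtain ⟨hyY, z, hzZ, hyz⟩ := hy
  obtain ⟨T₁, hT₁, hT₁c, hT₁s⟩ := hY y hyY
  obtain ⟨T₂, hT₂, hT₂c, hT₂s⟩ := hZ z hzZ
  have hd₁ : Disjoint T₁ T₂ := by
    refine Finset.disjoint_left.2 fun i hi hi' => ?_
    exact (Finset.mem_sdiff.1 (hVI (hT₂ hi'))).2 (hT₁ hi)
  have hd₂ : Disjoint (T₁ ∪ T₂) R := by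
    refine Finset.disjoint_left.2 fun i hi hi' => ?_
    have h := Finset.mem_sdiff.1 (hR hi')
    rcases Finset.mem_union.1 hi with h1 | h1
    · exact (Finset.mem_sdiff.1 h.1).2 (hT₁ h1)
    · exact h.2 (hT₂ h1)
  refine ⟨T₁ ∪ T₂ ∪ R, ?_, ?_, ?_⟩
  · refine Finset.union_subset (Finset.union_subset (hT₁.trans hUI) ?_) ?_
    · exact (hT₂.trans hVI).trans Finset.sdiff_subset
    · exact (hR.trans Finset.sdiff_subset).trans Finset.sdiff_subset
  · rw [Finset.card_union_of_disjoint hd₂, Finset.card_union_of_disjoint hd₁, hT₁c, hT₂c, hRc]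
    omega
  · rw [Finset.sum_union hd₂, Finset.sum_union hd₁, hT₁s, hT₂s, ← hyz]
    abel

/-- The kernel of an additive character, as a subgroup. -/
def addCharKer {G : Type*} [AddCommGroup G] (χ : AddChar G ℂ) : AddSubgroup G where
  carrier := {x | χ x = 1}
  zero_mem' := χ.map_zero_eq_one
  add_mem' {x y} hx hy := by
    rw [Set.mem_ofPred_eq] at *
    rw [AddChar.map_add_eq_mul, hx, hy, one_mul]
  neg_mem' {x} hx := by
    rw [Set.mem_ofPred_eq] at *
    rw [AddChar.map_neg_eq_inv, hx, inv_one]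

theorem mul_card_addCharKer_le {G : Type*} [AddCommGroup G] [Fintype G] {p : ℕ} (hp : p.Prime)
    (hG : ∀ x : G, p • x = 0) (χ : AddChar G ℂ) (hχ : χ ≠ 1) :
    p * Fintype.card (addCharKer χ) ≤ Fintype.card G := by
  obtain ⟨x, hx⟩ : ∃ x, χ x ≠ 1 := by
    by_contra! h
    exact hχ (by ext x; simp [h])
  have hdvd : p ∣ (addCharKer χ).index := by
    have hx' : (x : G ⧸ addCharKer χ) ≠ 0 := by
      rw [Ne, QuotientAddGroup.eq_zero_iff]
      exact hx
    have : Fact p.Prime := ⟨hp⟩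
    have h1 : addOrderOf (x : G ⧸ addCharKer χ) = p := by
      refine addOrderOf_eq_prime ?_ hx'
      rw [← QuotientAddGroup.mk_nsmul, hG, QuotientAddGroup.mk_zero]
    rw [← h1]
    exact addOrderOf_dvd_natCard _
  have h2 := (addCharKer χ).card_mul_index
  rw [Nat.card_eq_fintype_card, Nat.card_eq_fintype_card] at h2
  have hpos : 0 < (addCharKer χ).index := by
    rw [Nat.pos_iff_ne_zero]
    intro h0
    rw [h0, mul_zero] at h2
    exact Fintype.card_ne_zero h2.symm
  rw [← h2, mul_comm]
  exact Nat.mul_le_mul_left _ (Nat.le_of_dvd hpos hdvd)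

theorem exists_zero_sum_card_eq_prime {p J F r : ℕ} (hp : p.Prime) (hJ : J ≤ p) (hJ0 : 0 < J)
    (hFJ : 8 * p ≤ F * J) (hgrow : p ^ r * (4 * J) ^ (p / 2) ≤ (4 * J + 1) ^ (p / 2))
    {ι : Type*} (k : ℕ) (hk : k ≤ r) : ∀ {G : Type*} [AddCommGroup G] [Fintype G],
    (∀ x : G, p • x = 0) → Fintype.card G ≤ p ^ k → ∀ (s : ι → G) (I : Finset ι),
      F ^ k * p ≤ I.card → ∃ T ⊆ I, T.card = p ∧ ∑ i ∈ T, s i = 0 := by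
  induction k with
  | zero =>
    intro G _ _ hG hc s I hI
    have : Subsingleton G := Fintype.card_le_one_iff_subsingleton.1 (by simpa using hc)
    obtain ⟨T, hT, hTc⟩ := Finset.exists_subset_card_eq (show p ≤ I.card by simpa using hI)
    exact ⟨T, hT, hTc, Subsingleton.elim _ _⟩
  | succ k ih =>
    intro G _ _ hG hc s I hI
    by_cases hm : ∀ χ : AddChar G ℂ, χ ≠ 1 → ∀ ζ,
        (I.filter fun i => χ (s i) = ζ).card ≤ F ^ k * p
    · have hF : 8 ≤ F := by
        have : 8 * p ≤ F * p := hFJ.trans (Nat.mul_le_mul_left _ hJ)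
        exact Nat.le_of_mul_le_mul_right this hp.pos
      have hFk : 1 ≤ F ^ k := Nat.one_le_pow _ _ (by omega)
      have hX : 4 * p ≤ F ^ (k + 1) * p := by
        rw [pow_succ]
        exact Nat.mul_le_mul_right _ (by nlinarith)
      have hp2 := hp.two_le
      refine exists_zero_sum_of_not_concentrated hp hG hJ hJ0 (M := F ^ (k + 1) * p - 2 * p)
        (by omega) ?_ ?_ s I hm (by omega)
      · have h1 : F ^ (k + 1) * p ≤ 2 * (F ^ (k + 1) * p - 2 * p) := by omega
        have h2 : 8 * p * (F ^ k * p) ≤ F * J * (F ^ k * p) := Nat.mul_le_mul_right _ hFJ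
        have h3 : F * J * (F ^ k * p) = F ^ (k + 1) * p * J := by ring
        have h4 := Nat.mul_le_mul_right J h1
        nlinarith
      · refine le_trans (Nat.mul_le_mul_right _ (hc.trans ?_)) hgrow
        exact Nat.pow_le_pow_right hp.pos hk
    · push Not at hm
      obtain ⟨χ, hχ, ζ, hζ⟩ := hm
      obtain ⟨i₀, hi₀⟩ : (I.filter fun i => χ (s i) = ζ).Nonempty := by
        rw [← Finset.card_pos]
        omega
      have hi₀ := (Finset.mem_filter.1 hi₀).2
      have hζ0 : ζ ≠ 0 := by
        rintro rfl
        have := AddChar.map_nsmul_eq_pow χ p (s i₀)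
        rw [hG, AddChar.map_zero_eq_one, hi₀, zero_pow hp.ne_zero] at this
        exact one_ne_zero this
      have hs : ∀ i, ∃ y : addCharKer χ, χ (s i) = ζ → (y : G) = s i - s i₀ := by
        intro i
        by_cases h : χ (s i) = ζ
        · refine ⟨⟨s i - s i₀, ?_⟩, fun _ => rfl⟩
          change χ _ = 1
          rw [AddChar.map_sub_eq_div, h, hi₀, div_self hζ0]
        · exact ⟨0, fun h' => absurd h' h⟩
      choose t ht using hs
      have hcard := mul_card_addCharKer_le hp hG χ hχ
      obtain ⟨T, hT, hTc, hTs⟩ := ih (by omega) (G := addCharKer χ)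
        (fun x => Subtype.ext (by simpa using hG x))
        (by
          rw [pow_succ, mul_comm] at hc
          exact Nat.le_of_mul_le_mul_left (hcard.trans hc) hp.pos) t
        (I.filter fun i => χ (s i) = ζ) hζ.le
      refine ⟨T, hT.trans (Finset.filter_subset _ _), hTc, ?_⟩
      have h1 : ((∑ i ∈ T, t i : addCharKer χ) : G) = 0 := by rw [hTs]; rfl
      rw [AddSubgroup.val_finsetSum, Finset.sum_congr rfl fun i hi =>
        ht i (Finset.mem_filter.1 (hT hi)).2, Finset.sum_sub_distrib, Finset.sum_const, hTc, hG,
        sub_zero] at h1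
      exact h1

theorem eventually_mul_log_pow_le (C : ℝ) (k : ℕ) :
    ∀ᶠ p : ℕ in Filter.atTop, C * ((Nat.log 2 p + 1 : ℕ) : ℝ) ^ k ≤ p := by
  have hC : 0 < 1 / ((|C| + 1) * 3 ^ k) := by positivity
  have h1 := ((Real.isLittleO_pow_log_id_atTop (n := k)).bound hC)
  have h2 := tendsto_natCast_atTop_atTop (R := ℝ) |>.eventually h1
  filter_upwards [h2, Filter.eventually_ge_atTop 2] with p hp hp2
  have hp2' : (2 : ℝ) ≤ p := by exact_mod_cast hp2
  have hlog2 : (0.69 : ℝ) < Real.log 2 := by linarith [Real.log_two_gt_d9]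
  have hlogp : Real.log 2 ≤ Real.log p := Real.log_le_log (by norm_num) hp2'
  have hL : ((Nat.log 2 p + 1 : ℕ) : ℝ) ≤ 3 * Real.log p := by
    have h3 : (Nat.log 2 p : ℝ) * Real.log 2 ≤ Real.log p := by
      rw [← Real.log_pow]
      refine Real.log_le_log (by positivity) ?_
      exact_mod_cast Nat.pow_log_le_self 2 (by omega)
    push_cast
    nlinarith [(Nat.cast_nonneg (Nat.log 2 p) : (0 : ℝ) ≤ _)]
  rw [id, Real.norm_of_nonneg (by positivity), Real.norm_of_nonneg (by positivity)] at hp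
  calc C * ((Nat.log 2 p + 1 : ℕ) : ℝ) ^ k ≤ (|C| + 1) * (3 * Real.log p) ^ k := by
        gcongr
        linarith [le_abs_self C]
    _ = (|C| + 1) * 3 ^ k * Real.log p ^ k := by rw [mul_pow]; ring
    _ ≤ (|C| + 1) * 3 ^ k * (1 / ((|C| + 1) * 3 ^ k) * p) := by gcongr
    _ = p := by field_simp

theorem two_mul_pow_self_le (x : ℕ) (hx : 1 ≤ x) : 2 * x ^ x ≤ (x + 1) ^ x := by
  obtain ⟨y, rfl⟩ : ∃ y, x = y + 1 := ⟨x - 1, by omega⟩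
  rw [add_pow (y + 1) 1 (y + 1), Finset.sum_range_succ, Finset.sum_range_succ]
  simp only [one_pow, mul_one, Nat.choose_self, Nat.cast_one]
  have : (y + 1) ^ y * ((y + 1).choose y : ℕ) = (y + 1) ^ (y + 1) := by
    rw [Nat.choose_succ_self_right, pow_succ]
  push_cast at this ⊢
  omega

theorem exists_zero_sum_threshold (r : ℕ) (ε : ℝ) (hε : 0 < ε) :
    ∃ N : ℕ, ∀ p : ℕ, p.Prime → N ≤ p → ∃ f : ℕ, (f : ℝ) ≤ ε * (p : ℝ) ^ 2 ∧
      ∀ {G : Type} [AddCommGroup G] [Fintype G], (∀ x : G, p • x = 0) →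
        Fintype.card G ≤ p ^ r → ∀ {ι : Type} (s : ι → G) (I : Finset ι), f ≤ I.card →
          ∃ T ⊆ I, T.card = p ∧ ∑ i ∈ T, s i = 0 := by
  obtain ⟨N, hN⟩ := Filter.eventually_atTop.1
    ((eventually_mul_log_pow_le ((128 * (r + 1)) ^ r / ε) r).and
      (eventually_mul_log_pow_le (20 * (r + 1)) 1))
  refine ⟨N, fun p hp hNp => ?_⟩
  obtain ⟨h1, h2⟩ := hN p hNp
  obtain ⟨L, hL⟩ : ∃ L, L = Nat.log 2 p + 1 := ⟨_, rfl⟩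
  rw [← hL] at h1 h2
  have hL1 : 1 ≤ L := by omega
  have h2' : 20 * (r + 1) * L ≤ p := by
    rw [pow_one] at h2
    exact_mod_cast h2
  have hp2 := hp.two_le
  have hrL : 1 ≤ (r + 1) * L := Nat.mul_pos (by omega) hL1
  obtain ⟨F, hF⟩ : ∃ F, F = 128 * ((r + 1) * L) := ⟨_, rfl⟩
  have hF1 : 128 ≤ F := by omega
  obtain ⟨j, hj⟩ : ∃ j, j = 8 * p / F := ⟨_, rfl⟩
  have hJF : 8 * p ≤ F * (j + 1) := by
    rw [hj]
    exact (Nat.lt_mul_div_succ (8 * p) (show 0 < F by omega)).le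
  have hJF' : j * F ≤ 8 * p := by
    rw [hj]
    exact Nat.div_mul_le_self _ _
  have hJp : j + 1 ≤ p := by
    have : j * 128 ≤ 8 * p := (Nat.mul_le_mul_left _ hF1).trans hJF'
    omega
  have hJ4 : 4 * (j + 1) * (r * L) ≤ p / 2 := by
    have h3 : j * ((r + 1) * L) * 16 ≤ p := by
      rw [hF] at hJF'
      nlinarith
    have h4 : r * L ≤ (r + 1) * L := Nat.mul_le_mul_right _ (by omega)
    have h5 : 4 * (j + 1) * (r * L) ≤ 4 * (j + 1) * ((r + 1) * L) := Nat.mul_le_mul_left _ h4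
    have h6 : 4 * (j + 1) * ((r + 1) * L) = 4 * (j * ((r + 1) * L)) + 4 * ((r + 1) * L) := by
      ring
    have h7 : 20 * ((r + 1) * L) ≤ p := by linarith
    omega
  have hgrow : p ^ r * (4 * (j + 1)) ^ (p / 2) ≤ (4 * (j + 1) + 1) ^ (p / 2) := by
    have hpL : p ^ r ≤ 2 ^ (r * L) := by
      rw [mul_comm, pow_mul, hL]
      exact Nat.pow_le_pow_left (Nat.lt_pow_succ_log_self (by norm_num) p).le r
    obtain ⟨e, he⟩ := Nat.exists_eq_add_of_le hJ4
    obtain ⟨J, hJ⟩ : ∃ J, J = 4 * (j + 1) := ⟨_, rfl⟩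
    rw [he, ← hJ, pow_add, pow_add, pow_mul J, pow_mul (J + 1), ← mul_assoc]
    refine Nat.mul_le_mul ?_ (Nat.pow_le_pow_left (by omega) _)
    calc p ^ r * (J ^ J) ^ (r * L) ≤ 2 ^ (r * L) * (J ^ J) ^ (r * L) :=
          Nat.mul_le_mul_right _ hpL
      _ = (2 * J ^ J) ^ (r * L) := (mul_pow _ _ _).symm
      _ ≤ _ := Nat.pow_le_pow_left (two_mul_pow_self_le _ (by omega)) _
  refine ⟨F ^ r * p, ?_, ?_⟩
  · rw [div_mul_eq_mul_div, div_le_iff₀ hε, ← mul_pow] at h1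
    have hFc : (F : ℝ) = 128 * (r + 1) * (L : ℝ) := by
      rw [hF]
      push_cast
      ring
    push_cast
    rw [hFc]
    calc _ ≤ (p : ℝ) * ε * p := by gcongr
      _ = _ := by ring
  · intro G _ _ hG hc ι s I hI
    exact exists_zero_sum_card_eq_prime hp hJp (Nat.succ_pos _) hJF hgrow r le_rfl hG hc s I hI

theorem prod_one_sub_single_sub_one_mem {G k : Type*} [AddCommGroup G] [CommRing k]
    (S : Multiset G) :
    (S.map fun x => 1 - AddMonoidAlgebra.single x (1 : k)).prod - 1 ∈
      Submodule.span k {f : AddMonoidAlgebra k G |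
        ∃ T ≤ S, T ≠ 0 ∧ f = AddMonoidAlgebra.single T.sum 1} := by
  induction S using Multiset.induction_on with
  | empty => simp
  | cons x S ih =>
    set P := (S.map fun x => 1 - AddMonoidAlgebra.single x (1 : k)).prod with hP
    set A := Submodule.span k {f : AddMonoidAlgebra k G |
        ∃ T ≤ x ::ₘ S, T ≠ 0 ∧ f = AddMonoidAlgebra.single T.sum 1}
    have h1 : P - 1 ∈ A := by
      refine Submodule.span_mono ?_ ih
      rintro f ⟨T, hT, hT0, rfl⟩
      exact ⟨T, hT.trans (Multiset.le_cons_self _ _), hT0, rfl⟩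
    have h2 : AddMonoidAlgebra.single x (1 : k) * (P - 1) ∈ A := by
      have : Submodule.span k {f : AddMonoidAlgebra k G |
          ∃ T ≤ S, T ≠ 0 ∧ f = AddMonoidAlgebra.single T.sum 1} ≤
          A.comap (LinearMap.mulLeft k (AddMonoidAlgebra.single x (1 : k))) := by
        refine Submodule.span_le.2 ?_
        rintro f ⟨T, hT, hT0, rfl⟩
        refine Submodule.subset_span ⟨x ::ₘ T, Multiset.cons_le_cons _ hT,
          Multiset.cons_ne_zero, ?_⟩
        simp [AddMonoidAlgebra.single_mul_single]
      exact this ih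
    have h3 : AddMonoidAlgebra.single x (1 : k) ∈ A :=
      Submodule.subset_span ⟨{x}, by simp, by simp, by simp⟩
    have h4 := A.sub_mem (A.sub_mem h1 h2) h3
    rw [Multiset.map_cons, Multiset.prod_cons, ← hP]
    convert h4 using 1
    ring

theorem prod_one_sub_single_ne_zero {G : Type*} (k : Type*) [AddCommGroup G] [CommRing k]
    [Nontrivial k] {S : Multiset G} (hS : IsZeroSumFree S) :
    (S.map fun x => 1 - AddMonoidAlgebra.single x (1 : k)).prod ≠ 0 := by
  intro h0
  have h := prod_one_sub_single_sub_one_mem (k := k) S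
  rw [h0, zero_sub] at h
  have key : ∀ f ∈ Submodule.span k {f : AddMonoidAlgebra k G |
      ∃ T ≤ S, T ≠ 0 ∧ f = AddMonoidAlgebra.single T.sum 1}, f.coeff 0 = 0 := by
    intro f hf
    induction hf using Submodule.span_induction with
    | mem f hf =>
      obtain ⟨T, hT, hT0, rfl⟩ := hf
      simp [AddMonoidAlgebra.coeff_single, hS T hT hT0]
    | zero => simp
    | add f g _ _ hf hg => simp [hf, hg]
    | smul c f _ hf => simp [hf]
  have h1 := key _ h
  simp [AddMonoidAlgebra.one_def] at h1

theorem iSup_span_singleton_pow_eq_bot {R ι : Type*} [CommRing R] (u : ι → R) (q : ℕ)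
    (hu : ∀ i, u i ^ q = 0) (s : Finset ι) :
    (⨆ i ∈ s, Ideal.span {u i}) ^ (s.card * q + 1) = ⊥ := by
  induction s using Finset.induction_on with
  | empty => simp
  | insert i s hi ih =>
    rw [Finset.iSup_insert, Finset.card_insert_of_notMem hi, eq_bot_iff]
    have : (s.card + 1) * q + 1 = q + (s.card * q + 1) := by ring
    rw [this]
    refine Ideal.sup_pow_add_le_pow_sup_pow.trans ?_
    rw [ih, Ideal.span_singleton_pow, hu]
    simp

theorem multiset_prod_mem_pow_sum {R α : Type*} [CommRing R] (I : Ideal R) (f : α → R)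
    (w : α → ℕ) (S : Multiset α) (h : ∀ x ∈ S, f x ∈ I ^ w x) :
    (S.map f).prod ∈ I ^ (S.map w).sum := by
  induction S using Multiset.induction_on with
  | empty => simp
  | cons x S ih =>
    simp only [Multiset.map_cons, Multiset.prod_cons, Multiset.sum_cons, pow_add]
    exact Ideal.mul_mem_mul (h x (by simp)) (ih fun y hy => h y (by simp [hy]))

/-- The `i`-th standard basis vector of `(ℤ/nℤ)^r`, multiplied by `c`. -/
abbrev scaledBasis (r n c : ℕ) (i : Fin r) : Fin r → ZMod n := Pi.single i (c : ZMod n)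

theorem one_sub_single_mem_pow {r n p j : ℕ} [NeZero n] (hp : p.Prime) (x : Fin r → ZMod n)
    (hj : p ^ j • x = 0) (hjn : j ≤ n.factorization p) :
    1 - AddMonoidAlgebra.single x (1 : ZMod p) ∈
      (⨆ i ∈ (Finset.univ : Finset (Fin r)), Ideal.span {AddMonoidAlgebra.single
        (scaledBasis r n (n / p ^ n.factorization p) i) (1 : ZMod p) - 1}) ^
        p ^ (n.factorization p - j) := by
  set a := n.factorization p with ha
  set c := n / p ^ a with hc
  set I := ⨆ i ∈ (Finset.univ : Finset (Fin r)), Ideal.span {AddMonoidAlgebra.single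
        (scaledBasis r n c i) (1 : ZMod p) - 1} with hI
  have : Fact p.Prime := ⟨hp⟩
  have hn : n = c * (p ^ (a - j) * p ^ j) := by
    rw [← pow_add, Nat.sub_add_cancel hjn, hc]
    exact (Nat.div_mul_cancel (Nat.ordProj_dvd n p)).symm
  have hm : ∀ i, ∃ m : ℕ, x i = ((p ^ (a - j) * (m * c) : ℕ) : ZMod n) := by
    intro i
    have h1 : (p ^ j * (x i).val : ℕ) = (0 : ZMod n) := by
      have := congrFun hj i
      rw [Pi.smul_apply, nsmul_eq_mul] at this
      rw [Nat.cast_mul, ZMod.natCast_val, ZMod.cast_id]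
      exact this
    rw [ZMod.natCast_eq_zero_iff] at h1
    have h2 : c * p ^ (a - j) ∣ (x i).val := by
      refine Nat.dvd_of_mul_dvd_mul_right (pow_pos hp.pos j) ?_
      rw [mul_assoc, ← hn, mul_comm]
      exact h1
    obtain ⟨m, hm⟩ := h2
    refine ⟨m, ?_⟩
    rw [show p ^ (a - j) * (m * c) = (x i).val by rw [hm]; ring, ZMod.natCast_val, ZMod.cast_id]
  choose m hm using hm
  set y : Fin r → ZMod n := ∑ i, m i • scaledBasis r n c i with hy
  have hxy : x = p ^ (a - j) • y := by
    ext i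
    rw [hm, hy]
    simp [Finset.sum_apply, Pi.single_apply]
  have hyI : 1 - AddMonoidAlgebra.single y (1 : ZMod p) ∈ I := by
    rw [← Ideal.Quotient.eq_zero_iff_mem, map_sub, map_one, sub_eq_zero, eq_comm]
    have h1 : AddMonoidAlgebra.single y (1 : ZMod p) =
        ∏ i, AddMonoidAlgebra.single (scaledBasis r n c i) (1 : ZMod p) ^ m i := by
      have h2 := map_prod (AddMonoidAlgebra.of (ZMod p) (Fin r → ZMod n))
        (fun i => Multiplicative.ofAdd (scaledBasis r n c i) ^ m i) Finset.univ
      simp only [map_pow, AddMonoidAlgebra.of_apply] at h2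
      exact h2
    rw [h1, map_prod]
    refine Finset.prod_eq_one fun i _ => ?_
    rw [map_pow]
    have h2 : AddMonoidAlgebra.single (scaledBasis r n c i) (1 : ZMod p) - 1 ∈ I := by
      have : Ideal.span {AddMonoidAlgebra.single
          (scaledBasis r n c i) (1 : ZMod p) - 1} ≤ I :=
        le_iSup₂_of_le i (Finset.mem_univ i) le_rfl
      exact this (Ideal.mem_span_singleton_self _)
    rw [← Ideal.Quotient.eq_zero_iff_mem, map_sub, map_one, sub_eq_zero] at h2
    rw [h2, one_pow]
  have hchar : CharP (AddMonoidAlgebra (ZMod p) (Fin r → ZMod n)) p :=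
    charP_of_injective_algebraMap (algebraMap (ZMod p) _).injective p
  have h1 : 1 - AddMonoidAlgebra.single x (1 : ZMod p) =
      (1 - AddMonoidAlgebra.single y (1 : ZMod p)) ^ p ^ (a - j) := by
    rw [sub_pow_char_pow, one_pow, AddMonoidAlgebra.single_pow, one_pow, hxy]
  rw [h1]
  exact Ideal.pow_mem_pow hyI _

theorem crossNumber_le_of_prime_pow {r n p : ℕ} [NeZero n] (hp : p.Prime)
    {S : Multiset (Fin r → ZMod n)} (hS : IsZeroSumFree S)
    (hpow : ∀ x ∈ S, ∃ j, addOrderOf x = p ^ j) : crossNumber S ≤ r := by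
  have : Fact p.Prime := ⟨hp⟩
  set a := n.factorization p with ha
  have hn0 : n ≠ 0 := NeZero.ne n
  have hjn : ∀ x : Fin r → ZMod n, ∀ j, addOrderOf x = p ^ j → j ≤ a := by
    intro x j hj
    rw [ha, ← hp.pow_dvd_iff_le_factorization hn0, ← hj]
    exact addOrderOf_dvd_of_nsmul_eq_zero (by ext; simp)
  have hpow' : ∀ x ∈ S, p ^ a / addOrderOf x * addOrderOf x = p ^ a := fun x hx => by
    obtain ⟨j, hj⟩ := hpow x hx
    rw [hj]
    exact Nat.div_mul_cancel (pow_dvd_pow p (hjn x j hj))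
  have hmem : ∀ x ∈ S, 1 - AddMonoidAlgebra.single x (1 : ZMod p) ∈
      (⨆ i ∈ (Finset.univ : Finset (Fin r)), Ideal.span {AddMonoidAlgebra.single
        (scaledBasis r n (n / p ^ a) i) (1 : ZMod p) - 1}) ^
        (p ^ a / addOrderOf x) := by
    intro x hx
    obtain ⟨j, hj⟩ := hpow x hx
    rw [hj, Nat.pow_div (hjn x j hj) hp.pos]
    exact one_sub_single_mem_pow hp x (hj ▸ addOrderOf_nsmul_eq_zero x) (hjn x j hj)
  have hprod := multiset_prod_mem_pow_sum _ _ _ S hmem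
  have hchar : CharP (AddMonoidAlgebra (ZMod p) (Fin r → ZMod n)) p :=
    charP_of_injective_algebraMap (algebraMap (ZMod p) _).injective p
  have hnil := iSup_span_singleton_pow_eq_bot (fun i : Fin r => AddMonoidAlgebra.single
    (scaledBasis r n (n / p ^ a) i) (1 : ZMod p) - 1) (p ^ a) (fun i => by
      rw [sub_pow_char_pow, one_pow, AddMonoidAlgebra.single_pow, one_pow, ← Pi.single_smul,
        nsmul_eq_mul, ← Nat.cast_mul, Nat.mul_div_cancel' (Nat.ordProj_dvd n p)]
      simp [AddMonoidAlgebra.one_def]) Finset.univ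
  have hlt : (S.map fun x => p ^ a / addOrderOf x).sum ≤ r * p ^ a := by
    by_contra! h
    refine prod_one_sub_single_ne_zero (ZMod p) hS ?_
    rw [← Ideal.mem_bot, ← hnil, Finset.card_univ, Fintype.card_fin]
    exact Ideal.pow_le_pow_right h hprod
  have hpa : (0 : ℝ) < (p : ℝ) ^ a := pow_pos (by exact_mod_cast hp.pos) a
  have hcross : crossNumber S * (p : ℝ) ^ a = ((S.map fun x => p ^ a / addOrderOf x).sum : ℕ) := by
    rw [crossNumber, ← Multiset.sum_map_mul_right, Nat.cast_multiset_sum, Multiset.map_map]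
    congr 1
    refine Multiset.map_congr rfl fun x hx => ?_
    have h := hpow' x hx
    have h0 : (addOrderOf x : ℝ) ≠ 0 := by
      have : addOrderOf x ≠ 0 := fun h0 => by
        rw [h0, mul_zero] at h
        exact (pow_ne_zero a hp.ne_zero) h.symm
      exact_mod_cast this
    rw [Function.comp, one_div_mul_eq_div, div_eq_iff h0]
    exact_mod_cast h.symm
  refine le_of_mul_le_mul_right ?_ hpa
  rw [hcross]
  exact_mod_cast hlt

theorem card_smul_eq_zero_le {r n p : ℕ} [NeZero n] (hp : 0 < p) :
    Nat.card (nsmulAddMonoidHom (α := Fin r → ZMod n) p).ker ≤ p ^ r := by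
  let φ : (nsmulAddMonoidHom (α := Fin r → ZMod n) p).ker →
      (Fin r → {x : ZMod n // x ∈ Finset.univ.filter fun x : ZMod n => p • x = 0}) :=
    fun x i => ⟨x.1 i, by simpa using congrFun x.2 i⟩
  have hφ : Function.Injective φ := by
    intro x y h
    ext i
    exact congrArg Subtype.val (congrFun h i)
  refine (Nat.card_le_card_of_injective φ hφ).trans ?_
  rw [Nat.card_eq_fintype_card, Fintype.card_fun, Fintype.card_fin, Fintype.card_coe]
  exact Nat.pow_le_pow_left (IsAddCyclic.card_nsmul_eq_zero_le hp) r

theorem crossNumber_add {G : Type*} [AddCommGroup G] (S T : Multiset G) :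
    crossNumber (S + T) = crossNumber S + crossNumber T := by
  simp [crossNumber]

theorem crossNumber_eq_of_forall_addOrderOf {G : Type*} [AddCommGroup G] {S : Multiset G} {d : ℕ}
    (h : ∀ x ∈ S, addOrderOf x = d) : crossNumber S = (Multiset.card S : ℝ) / d := by
  rw [crossNumber, Multiset.map_congr rfl fun x hx => by rw [h x hx], Multiset.map_const',
    Multiset.sum_replicate, nsmul_eq_mul]
  ring

theorem crossNumber_le_sum_filter {G ι : Type*} [AddCommGroup G] (P : Finset ι)
    (Q : ι → G → Prop) [∀ i, DecidablePred (Q i)] (S : Multiset G)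
    (h : ∀ x ∈ S, ∃ i ∈ P, Q i x) :
    crossNumber S ≤ ∑ i ∈ P, crossNumber (S.filter (Q i)) := by
  induction S using Multiset.induction_on with
  | empty => simp [crossNumber]
  | cons x S ih =>
    have h1 := ih fun y hy => h y (Multiset.mem_cons_of_mem hy)
    have h2 : ∀ i, crossNumber ((x ::ₘ S).filter (Q i)) =
        (if Q i x then (1 : ℝ) / addOrderOf x else 0) + crossNumber (S.filter (Q i)) := by
      intro i
      by_cases hi : Q i x <;> simp [hi, crossNumber]
    obtain ⟨i, hi, hix⟩ := h x (Multiset.mem_cons_self x S)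
    have h3 : (1 : ℝ) / addOrderOf x ≤
        ∑ i ∈ P, (if Q i x then (1 : ℝ) / addOrderOf x else 0) := by
      refine le_trans (by simp [hix]) (Finset.single_le_sum (f := fun i =>
        if Q i x then (1 : ℝ) / addOrderOf x else 0) (fun i _ => ?_) hi)
      positivity
    rw [Finset.sum_congr rfl fun i _ => h2 i, Finset.sum_add_distrib]
    have h4 : crossNumber (x ::ₘ S) = (1 : ℝ) / addOrderOf x + crossNumber S := by
      simp [crossNumber]
    linarith

theorem IsZeroSumFree.mono {G : Type*} [AddCommGroup G] {S T : Multiset G}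
    (hS : IsZeroSumFree S) (h : T ≤ S) : IsZeroSumFree T :=
  fun U hU => hS U (hU.trans h)

theorem IsZeroSumFree.cons_sum_sub {G : Type*} [AddCommGroup G] [DecidableEq G] {S T : Multiset G}
    (hS : IsZeroSumFree S) (h : T ≤ S) (hT : T ≠ 0) : IsZeroSumFree (T.sum ::ₘ (S - T)) := by
  intro U hU hU0 hsum
  by_cases hm : T.sum ∈ U
  · obtain ⟨W, rfl⟩ := Multiset.exists_cons_of_mem hm
    have hW : W ≤ S - T := (Multiset.cons_le_cons_iff _).1 hU
    refine hS (T + W) ?_ (by simp [hT]) (by simpa using hsum)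
    calc T + W ≤ T + (S - T) := by gcongr
      _ = S := add_tsub_cancel_of_le h
  · exact hS U (((Multiset.le_cons_of_notMem hm).1 hU).trans tsub_le_self) hU0 hsum

theorem exists_sub_multiset_of_threshold {r n p f : ℕ} [NeZero n] (hp : p.Prime)
    (hf : ∀ {G : Type} [AddCommGroup G] [Fintype G], (∀ x : G, p • x = 0) →
      Fintype.card G ≤ p ^ r → ∀ {ι : Type} (s : ι → G) (I : Finset ι), f ≤ I.card →
        ∃ T ⊆ I, T.card = p ∧ ∑ i ∈ T, s i = 0)
    (U : Multiset (Fin r → ZMod n)) (c : ℕ) (hU : ∀ x ∈ U, p • c • x = 0)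
    (hcard : f ≤ Multiset.card U) : ∃ T ≤ U, Multiset.card T = p ∧ c • T.sum = 0 := by
  let H := (nsmulAddMonoidHom (α := Fin r → ZMod n) p).ker
  have : Fintype H := Fintype.ofFinite H
  obtain ⟨T, -, hT, hsum⟩ := hf (G := H) (fun x => Subtype.ext x.2)
    (by rw [← Nat.card_eq_fintype_card]; exact card_smul_eq_zero_le hp.pos)
    (fun i : U => (⟨c • i.1, hU i.1 Multiset.coe_mem⟩ : H)) Finset.univ
    (by rwa [Finset.card_univ, Multiset.card_coe])
  refine ⟨T.val.map fun i : U => i.1, ?_, by simpa using hT, ?_⟩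
  · calc T.val.map (fun i : U => i.1) ≤ (Finset.univ : Finset U).val.map fun i : U => i.1 :=
          Multiset.map_le_map (Finset.val_le_iff.2 (Finset.subset_univ T))
      _ = U := Multiset.map_univ_coe U
  · have := congrArg H.subtype hsum
    rw [map_sum, map_zero] at this
    rw [← this, Multiset.smul_sum, Multiset.map_map]
    rfl

theorem exists_zeroSumFree_card_filter_lt {r n : ℕ} [NeZero n] (f : ℕ → ℕ)
    (hf : ∀ p, p.Prime → p ∣ n → ∀ (U : Multiset (Fin r → ZMod n)) (c : ℕ),
      (∀ x ∈ U, p • c • x = 0) → f p ≤ Multiset.card U →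
        ∃ T ≤ U, Multiset.card T = p ∧ c • T.sum = 0)
    (S : Multiset (Fin r → ZMod n)) (hS : IsZeroSumFree S) :
    ∃ S' : Multiset (Fin r → ZMod n), IsZeroSumFree S' ∧ crossNumber S ≤ crossNumber S' ∧
      ∀ d ∈ n.divisors, d ≠ 1 →
        Multiset.card (S'.filter fun x => addOrderOf x = d) < f d.minFac := by
  induction hk : Multiset.card S using Nat.strong_induction_on generalizing S with
  | _ k ih =>
  by_cases h : ∀ d ∈ n.divisors, d ≠ 1 →
      Multiset.card (S.filter fun x => addOrderOf x = d) < f d.minFac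
  · exact ⟨S, hS, le_rfl, h⟩
  push Not at h
  obtain ⟨d, hd, hd1, hcard⟩ := h
  have hdn := Nat.dvd_of_mem_divisors hd
  have hd0 : d ≠ 0 := fun h0 => NeZero.ne n (by simpa [h0] using hdn)
  have hp := Nat.minFac_prime hd1
  set p := d.minFac with hpd
  have hpdvd : p ∣ d := Nat.minFac_dvd d
  obtain ⟨c, hc⟩ := hpdvd
  have hc0 : 0 < c := Nat.pos_of_ne_zero fun h0 => hd0 (by rw [hc, h0, mul_zero])
  obtain ⟨T, hTU, hTc, hT⟩ := hf p hp ((Nat.minFac_dvd d).trans hdn)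
    (S.filter fun x => addOrderOf x = d) c (fun x hx => by
      rw [← mul_smul, ← hc, ← (Multiset.mem_filter.1 hx).2]
      exact addOrderOf_nsmul_eq_zero x) hcard
  have hTS : T ≤ S := hTU.trans (Multiset.filter_le _ _)
  have hT0 : T ≠ 0 := by
    rintro rfl
    exact hp.ne_zero (by simpa using hTc.symm)
  have hle : Multiset.card T ≤ Multiset.card S := Multiset.card_le_card hTS
  have h2 := hp.two_le
  obtain ⟨S', h1, h3, h4⟩ := ih (Multiset.card (T.sum ::ₘ (S - T)))
    (by rw [Multiset.card_cons, Multiset.card_sub hTS]; omega) _ (hS.cons_sum_sub hTS hT0) rfl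
  refine ⟨S', h1, le_trans ?_ h3, h4⟩
  have h5 : crossNumber T = 1 / (c : ℝ) := by
    rw [crossNumber_eq_of_forall_addOrderOf fun x hx =>
      (Multiset.mem_filter.1 (Multiset.mem_of_le hTU hx)).2, hTc, hc, Nat.cast_mul]
    have : (p : ℝ) ≠ 0 := by exact_mod_cast hp.ne_zero
    field_simp
  have h6 : (1 : ℝ) / c ≤ 1 / addOrderOf T.sum := by
    have h7 : addOrderOf T.sum ∣ c := addOrderOf_dvd_of_nsmul_eq_zero hT
    have h8 : 0 < addOrderOf T.sum := Nat.pos_of_dvd_of_pos h7 hc0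
    exact one_div_le_one_div_of_le (by exact_mod_cast h8)
      (by exact_mod_cast Nat.le_of_dvd hc0 h7)
  calc crossNumber S = crossNumber T + crossNumber (S - T) := by
        rw [← crossNumber_add, add_tsub_cancel_of_le hTS]
    _ ≤ 1 / addOrderOf T.sum + crossNumber (S - T) := by rw [h5]; gcongr
    _ = crossNumber (T.sum ::ₘ (S - T)) := by simp [crossNumber]

theorem sum_divisors_inv_le (n : ℕ) (hn : n ≠ 0) :
    ∑ e ∈ n.divisors, (1 : ℝ) / e ≤ 2 ^ n.primeFactors.card := by
  have hgeom : ∀ p : ℕ, 2 ≤ p → ∀ a, ∑ k ∈ Finset.range (a + 1), p ^ k ≤ 2 * p ^ a := by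
    intro p hp a
    induction a with
    | zero => simp
    | succ a ih =>
      rw [Finset.sum_range_succ, pow_succ]
      nlinarith [pow_pos (show 0 < p by omega) a]
  have h1 : ∑ d ∈ n.divisors, d ≤ 2 ^ n.primeFactors.card * n := by
    rw [Nat.sum_divisors hn]
    calc _ ≤ ∏ p ∈ n.primeFactors, 2 * p ^ n.factorization p :=
          Finset.prod_le_prod' fun p hp => hgeom p (Nat.prime_of_mem_primeFactors hp).two_le _
      _ = 2 ^ n.primeFactors.card * n := by
          rw [Finset.prod_mul_distrib, Finset.prod_const]
          congr 1
          exact Nat.prod_factorization_pow_eq_self hn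
  have hn' : (0 : ℝ) < n := by exact_mod_cast Nat.pos_of_ne_zero hn
  refine le_of_mul_le_mul_right ?_ hn'
  rw [Finset.sum_mul]
  calc ∑ e ∈ n.divisors, (1 : ℝ) / e * n = ∑ e ∈ n.divisors, ((n / e : ℕ) : ℝ) := by
        refine Finset.sum_congr rfl fun e he => ?_
        have he0 : (e : ℝ) ≠ 0 := by exact_mod_cast (Nat.pos_of_mem_divisors he).ne'
        rw [Nat.cast_div (Nat.dvd_of_mem_divisors he) he0]
        ring
    _ = ((∑ e ∈ n.divisors, e : ℕ) : ℝ) := by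
        rw [Nat.cast_sum]
        exact Nat.sum_div_divisors n fun e => (e : ℝ)
    _ ≤ _ := by exact_mod_cast h1

theorem sum_divisors_filter_dvd_le (n m : ℕ) (hn : n ≠ 0) :
    ∑ d ∈ n.divisors with m ∣ d, (m : ℝ) / d ≤ 2 ^ n.primeFactors.card := by
  refine le_trans ?_ (sum_divisors_inv_le n hn)
  have hinj : Set.InjOn (fun d => d / m) (n.divisors.filter (m ∣ ·)) := by
    intro a ha b hb h
    simp only [Finset.coe_filter, Set.mem_ofPred_eq] at ha hb
    rw [← Nat.div_mul_cancel ha.2, ← Nat.div_mul_cancel hb.2]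
    exact congrArg (· * m) h
  calc ∑ d ∈ n.divisors with m ∣ d, (m : ℝ) / d
      = ∑ d ∈ n.divisors with m ∣ d, (1 : ℝ) / ((d / m : ℕ) : ℝ) := by
        refine Finset.sum_congr rfl fun d hd => ?_
        obtain ⟨hd, hmd⟩ := Finset.mem_filter.1 hd
        have hm : (m : ℝ) ≠ 0 := by
          rintro h
          rw [Nat.cast_eq_zero.1 h, zero_dvd_iff] at hmd
          exact (Nat.pos_of_mem_divisors hd).ne' hmd
        rw [Nat.cast_div hmd hm, one_div_div]
    _ = ∑ e ∈ (n.divisors.filter (m ∣ ·)).image fun d => d / m, (1 : ℝ) / e :=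
        (Finset.sum_image (f := fun e : ℕ => (1 : ℝ) / e) hinj).symm
    _ ≤ _ := by
        refine Finset.sum_le_sum_of_subset_of_nonneg ?_ fun _ _ _ => by positivity
        intro e he
        obtain ⟨d, hd, rfl⟩ := Finset.mem_image.1 he
        obtain ⟨hd, hmd⟩ := Finset.mem_filter.1 hd
        exact Nat.mem_divisors.2 ⟨(Nat.div_dvd_of_dvd hmd).trans (Nat.dvd_of_mem_divisors hd), hn⟩

theorem sum_minFac_sq_div_le (n : ℕ) (hn : n ≠ 0) (hn1 : n ≠ 1) :
    ∑ d ∈ n.divisors with ¬ ∃ p ∈ n.primeFactors, ∃ j, d = p ^ j, (d.minFac : ℝ) ^ 2 / d ≤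
      (n.primeFactors.card : ℝ) ^ 2 * 2 ^ n.primeFactors.card := by
  set P := n.primeFactors with hP
  have hterm : ∀ d ∈ n.divisors.filter fun d => ¬ ∃ p ∈ P, ∃ j, d = p ^ j,
      (d.minFac : ℝ) ^ 2 / d ≤ ∑ x ∈ P ×ˢ P,
        if x.1 * x.2 ∣ d then ((x.1 * x.2 : ℕ) : ℝ) / d else 0 := by
    intro d hd
    obtain ⟨hd, hpp⟩ := Finset.mem_filter.1 hd
    have hdn := Nat.dvd_of_mem_divisors hd
    have hd0 : d ≠ 0 := (Nat.pos_of_mem_divisors hd).ne'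
    have hd1 : d ≠ 1 := by
      rintro rfl
      exact hpp ⟨n.minFac, Nat.mem_primeFactors.2
        ⟨Nat.minFac_prime hn1, Nat.minFac_dvd n, hn⟩, 0, rfl⟩
    have hp := Nat.minFac_prime hd1
    have hpP : d.minFac ∈ P := Nat.mem_primeFactors.2 ⟨hp, (Nat.minFac_dvd d).trans hdn, hn⟩
    obtain ⟨q, hq, hqd, hqp⟩ : ∃ q, q.Prime ∧ q ∣ d ∧ q ≠ d.minFac := by
      by_contra! h
      exact hpp ⟨_, hpP, _, Nat.eq_prime_pow_of_unique_prime_dvd hd0 fun {q} hq hqd => h q hq hqd⟩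
    have hqP : q ∈ P := Nat.mem_primeFactors.2 ⟨hq, hqd.trans hdn, hn⟩
    have hdvd : d.minFac * q ∣ d :=
      ((Nat.coprime_primes hp hq).2 (Ne.symm hqp)).mul_dvd_of_dvd_of_dvd (Nat.minFac_dvd d) hqd
    refine le_trans ?_ (Finset.single_le_sum (f := fun x : ℕ × ℕ =>
      if x.1 * x.2 ∣ d then ((x.1 * x.2 : ℕ) : ℝ) / d else 0) (fun _ _ => by positivity)
      (Finset.mk_mem_product hpP hqP))
    have hle : (d.minFac : ℝ) ≤ q := by exact_mod_cast Nat.minFac_le_of_dvd hq.two_le hqd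
    simp only [hdvd, if_true, Nat.cast_mul, sq]
    gcongr
  calc _ ≤ ∑ d ∈ n.divisors with ¬ ∃ p ∈ P, ∃ j, d = p ^ j, ∑ x ∈ P ×ˢ P,
        (if x.1 * x.2 ∣ d then ((x.1 * x.2 : ℕ) : ℝ) / d else 0) := Finset.sum_le_sum hterm
    _ ≤ ∑ d ∈ n.divisors, ∑ x ∈ P ×ˢ P,
        (if x.1 * x.2 ∣ d then ((x.1 * x.2 : ℕ) : ℝ) / d else 0) :=
      Finset.sum_le_sum_of_subset_of_nonneg (Finset.filter_subset _ _) fun _ _ _ =>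
        Finset.sum_nonneg fun _ _ => by positivity
    _ = ∑ x ∈ P ×ˢ P, ∑ d ∈ n.divisors with x.1 * x.2 ∣ d, ((x.1 * x.2 : ℕ) : ℝ) / d := by
      rw [Finset.sum_comm]
      exact Finset.sum_congr rfl fun x _ => (Finset.sum_filter _ _).symm
    _ ≤ ∑ x ∈ P ×ˢ P, (2 : ℝ) ^ P.card :=
      Finset.sum_le_sum fun x _ => sum_divisors_filter_dvd_le n _ hn
    _ = (P.card : ℝ) ^ 2 * 2 ^ P.card := by
      rw [Finset.sum_const, Finset.card_product, nsmul_eq_mul, Nat.cast_mul, sq]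

theorem exists_crossNumber_le (r l : ℕ) (hl : 1 ≤ l) (ε : ℝ) (hε : 0 < ε) :
    ∃ N : ℕ, ∀ n : ℕ, n ≠ 0 → n.primeFactors.card = l → N ≤ n.minFac →
      ∀ S : Multiset (Fin r → ZMod n), IsZeroSumFree S → crossNumber S ≤ (r : ℝ) * l + ε := by
  set C : ℝ := (l : ℝ) ^ 2 * 2 ^ l with hC
  have hl0 : (0 : ℝ) < l := by exact_mod_cast hl
  have hC0 : 0 < C := by positivity
  obtain ⟨N, hN⟩ := exists_zero_sum_threshold r (ε / C) (by positivity)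
  refine ⟨N, fun n hn hcard hmin S hS => ?_⟩
  have : NeZero n := ⟨hn⟩
  have hn1 : n ≠ 1 := by
    rintro rfl
    simp at hcard
    omega
  have hNp : ∀ p, p.Prime → p ∣ n → N ≤ p := fun p hp hpn =>
    hmin.trans (Nat.minFac_le_of_dvd hp.two_le hpn)
  have hex : ∀ p : ℕ, ∃ f : ℕ, p.Prime → p ∣ n → (f : ℝ) ≤ ε / C * (p : ℝ) ^ 2 ∧
      ∀ (U : Multiset (Fin r → ZMod n)) (c : ℕ), (∀ x ∈ U, p • c • x = 0) →
        f ≤ Multiset.card U → ∃ T ≤ U, Multiset.card T = p ∧ c • T.sum = 0 := by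
    intro p
    by_cases hp : p.Prime ∧ p ∣ n
    · obtain ⟨f, hf, hf'⟩ := hN p hp.1 (hNp p hp.1 hp.2)
      exact ⟨f, fun _ _ => ⟨hf, exists_sub_multiset_of_threshold hp.1 hf'⟩⟩
    · exact ⟨0, fun h h' => absurd ⟨h, h'⟩ hp⟩
  choose f hf using hex
  obtain ⟨S', hS', hle, hlt⟩ := exists_zeroSumFree_card_filter_lt f
    (fun p hp hpn => (hf p hp hpn).2) S hS
  refine hle.trans ?_
  set Q : ℕ → Prop := fun d => ∃ p ∈ n.primeFactors, ∃ j, d = p ^ j with hQ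
  have hsplit : crossNumber S' = crossNumber (S'.filter fun x => Q (addOrderOf x)) +
      crossNumber (S'.filter fun x => ¬ Q (addOrderOf x)) := by
    rw [← crossNumber_add, Multiset.filter_add_not]
  have h1 : crossNumber (S'.filter fun x => Q (addOrderOf x)) ≤ (r : ℝ) * l := by
    refine (crossNumber_le_sum_filter n.primeFactors (fun p x => ∃ j, addOrderOf x = p ^ j) _
      fun x hx => (Multiset.mem_filter.1 hx).2).trans ?_
    refine (Finset.sum_le_sum fun p hp => crossNumber_le_of_prime_pow
      (Nat.prime_of_mem_primeFactors hp)
      (hS'.mono ((Multiset.filter_le _ _).trans (Multiset.filter_le _ _)))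
      fun x hx => (Multiset.mem_filter.1 hx).2).trans ?_
    rw [Finset.sum_const, hcard, nsmul_eq_mul, mul_comm]
  have hdvd : ∀ x : Fin r → ZMod n, addOrderOf x ∈ n.divisors := fun x =>
    Nat.mem_divisors.2 ⟨addOrderOf_dvd_of_nsmul_eq_zero (by ext; simp), hn⟩
  have h2 : crossNumber (S'.filter fun x => ¬ Q (addOrderOf x)) ≤ ε := by
    refine (crossNumber_le_sum_filter (n.divisors.filter fun d => ¬ Q d)
      (fun d x => addOrderOf x = d) _ fun x hx => ⟨addOrderOf x, Finset.mem_filter.2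
        ⟨hdvd x, (Multiset.mem_filter.1 hx).2⟩, rfl⟩).trans ?_
    calc _ ≤ ∑ d ∈ n.divisors with ¬ Q d, ε / C * ((d.minFac : ℝ) ^ 2 / d) := by
          refine Finset.sum_le_sum fun d hd => ?_
          obtain ⟨hd, hdQ⟩ := Finset.mem_filter.1 hd
          have hd1 : d ≠ 1 := by
            rintro rfl
            exact hdQ ⟨n.minFac, Nat.mem_primeFactors.2
              ⟨Nat.minFac_prime hn1, Nat.minFac_dvd n, hn⟩, 0, rfl⟩
          refine (crossNumber_eq_of_forall_addOrderOf fun x hx =>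
            (Multiset.mem_filter.1 hx).2).trans_le ?_
          rw [← mul_div_assoc]
          gcongr
          refine le_trans ?_ (hf d.minFac (Nat.minFac_prime hd1)
            ((Nat.minFac_dvd d).trans (Nat.dvd_of_mem_divisors hd))).1
          exact_mod_cast (Multiset.card_le_card (Multiset.filter_le_filter _
            (Multiset.filter_le _ _))).trans (hlt d hd hd1).le
      _ ≤ ε / C * C := by
          rw [← Finset.mul_sum]
          gcongr
          have := sum_minFac_sq_div_le n hn hn1
          rwa [hcard] at this
      _ = ε := div_mul_cancel₀ ε hC0.ne'
  linarith

theorem IsZeroSumFree.map_of_injective {G H : Type*} [AddCommGroup G] [AddCommGroup H]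
    {φ : G →+ H} (hφ : Function.Injective φ) {S : Multiset G} (hS : IsZeroSumFree S) :
    IsZeroSumFree (S.map φ) := by
  intro T hT hT0 hsum
  have hinv := Function.leftInverse_invFun hφ
  have hU : T.map (Function.invFun φ) ≤ S := by
    refine (Multiset.map_le_map hT).trans_eq ?_
    rw [Multiset.map_map, hinv.comp_eq_id, Multiset.map_id]
  have hUT : (T.map (Function.invFun φ)).map φ = T := by
    rw [Multiset.map_map]
    conv_rhs => rw [← Multiset.map_id T]
    refine Multiset.map_congr rfl fun y hy => ?_
    obtain ⟨x, -, rfl⟩ := Multiset.mem_map.1 (Multiset.mem_of_le hT hy)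
    exact congrArg φ (hinv x)
  refine hS _ hU (by simpa using hT0) (hφ ?_)
  rw [map_multiset_sum, hUT, hsum, map_zero]

theorem crossNumber_map_of_injective {G H : Type*} [AddCommGroup G] [AddCommGroup H]
    {φ : G →+ H} (hφ : Function.Injective φ) (S : Multiset G) :
    crossNumber (S.map φ) = crossNumber S := by
  simp [crossNumber, Multiset.map_map, addOrderOf_injective φ hφ]

theorem exists_injective_pi_zmod {r m : ℕ} (n : Fin r → ℕ) (hm : m ≠ 0) (h : ∀ i, n i ∣ m) :
    ∃ φ : (∀ i, ZMod (n i)) →+ (Fin r → ZMod m), Function.Injective φ := by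
  have h1 : ∀ i, ∃ ψ : ZMod (n i) →+ ZMod m, Function.Injective ψ := by
    intro i
    obtain ⟨c, hc⟩ := h i
    have hc0 : c ≠ 0 := by rintro rfl; simp [hc] at hm
    have hx : zmultiplesHom (ZMod m) (c : ZMod m) (n i : ℤ) = 0 := by
      rw [zmultiplesHom_apply, natCast_zsmul, nsmul_eq_mul, ← Nat.cast_mul, ← hc,
        ZMod.natCast_self]
    refine ⟨ZMod.lift (n i) ⟨zmultiplesHom (ZMod m) (c : ZMod m), hx⟩, ?_⟩
    rw [ZMod.lift_injective]
    intro k hk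
    simp only [zmultiplesHom_apply, zsmul_eq_mul] at hk
    rw [← Int.cast_natCast, ← Int.cast_mul, ZMod.intCast_zmod_eq_zero_iff_dvd, hc,
      Nat.cast_mul] at hk
    rw [ZMod.intCast_zmod_eq_zero_iff_dvd]
    exact Int.dvd_of_mul_dvd_mul_right (by exact_mod_cast hc0) hk
  choose ψ hψ using h1
  refine ⟨⟨⟨fun x i => ψ i (x i), by ext; simp⟩, fun x y => by ext; simp⟩, fun x y hxy => ?_⟩
  exact funext fun i => hψ i (congrFun hxy i)

theorem IsMinimalZeroSum.crossNumber_le {G : Type*} [AddCommGroup G] {S : Multiset G}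
    {B δ : ℝ} (hB0 : 1 ≤ B) (hS : IsMinimalZeroSum S)
    (hB : ∀ T : Multiset G, IsZeroSumFree T → crossNumber T ≤ B)
    (hδ0 : 0 ≤ δ) (hδ : ∀ g : G, g ≠ 0 → (1 : ℝ) / addOrderOf g ≤ δ) :
    crossNumber S ≤ B + δ := by
  rcases S.empty_or_exists_mem with rfl | ⟨g, hg⟩
  · simp [crossNumber]
    linarith
  obtain ⟨T, rfl⟩ := Multiset.exists_cons_of_mem hg
  have hT : IsZeroSumFree T := fun U hU =>
    hS.2 U (lt_of_le_of_lt hU (Multiset.lt_cons_self T g))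
  have h1 : crossNumber (g ::ₘ T) = 1 / addOrderOf g + crossNumber T := by simp [crossNumber]
  rw [h1]
  by_cases hg0 : g = 0
  · have hT0 : T = 0 := by
      by_contra h
      exact hT T le_rfl h (by simpa [hg0] using hS.1)
    rw [hg0, hT0]
    simp [crossNumber]
    linarith
  · linarith [hδ g hg0, hB T hT]

theorem davenport_le {G : Type*} [AddCommGroup G] {m : ℕ} (hm : 0 < m) {B : ℝ} (hB0 : 0 ≤ B)
    (hexp : ∀ g : G, m • g = 0)
    (hB : ∀ T : Multiset G, IsZeroSumFree T → crossNumber T ≤ B) :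
    (davenport G : ℝ) ≤ B * m + 1 := by
  have hm' : (0 : ℝ) < m := by exact_mod_cast hm
  have h : davenport G ≤ ⌊B * m⌋₊ + 1 := by
    refine Nat.sInf_le ⟨by omega, fun S hS => ?_⟩
    by_contra! hcon
    have h1 := hB S hcon
    have h2 : (Multiset.card S : ℝ) / m ≤ crossNumber S := by
      have : (Multiset.card S : ℝ) / m = (S.map fun _ => (1 : ℝ) / m).sum := by
        rw [Multiset.map_const', Multiset.sum_replicate, nsmul_eq_mul]
        ring
      rw [this]
      refine Multiset.sum_map_le_sum_map _ _ fun g _ => ?_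
      have h3 := addOrderOf_dvd_of_nsmul_eq_zero (hexp g)
      exact one_div_le_one_div_of_le (by exact_mod_cast Nat.pos_of_dvd_of_pos h3 hm)
        (by exact_mod_cast Nat.le_of_dvd hm h3)
    have h3 : (Multiset.card S : ℝ) ≤ B * m := (div_le_iff₀ hm').1 (h2.trans h1)
    have := Nat.le_floor h3
    omega
  calc (davenport G : ℝ) ≤ ((⌊B * m⌋₊ + 1 : ℕ) : ℝ) := by exact_mod_cast h
    _ ≤ B * m + 1 := by
      push_cast
      gcongr
      exact Nat.floor_le (by positivity)

theorem stmt19 (r l : ℕ) (hr : 1 ≤ r) (hl : 1 ≤ l) :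
    ∀ ε : ℝ, 0 < ε → ∃ N : ℕ, ∀ n : Fin r → ℕ,
      (∀ i, 1 < n i) → (∀ i j : Fin r, i ≤ j → n i ∣ n j) →
      (n ⟨r - 1, by omega⟩).primeFactors.card = l →
      N ≤ (n ⟨r - 1, by omega⟩).minFac →
      littleCrossNumber (∀ i : Fin r, ZMod (n i)) ≤ (r : ℝ) * l + ε ∧
      bigCrossNumber (∀ i : Fin r, ZMod (n i)) ≤ (r : ℝ) * l + ε ∧
      (davenport (∀ i : Fin r, ZMod (n i)) : ℝ) ≤
        ((r : ℝ) * l + ε) * (n ⟨r - 1, by omega⟩ : ℝ) := by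
  intro ε hε
  obtain ⟨N, hN⟩ := exists_crossNumber_le r l hl (ε / 2) (by positivity)
  refine ⟨max N ⌈2 / ε⌉₊, fun n hn1 hdvd hcard hmin => ?_⟩
  set m := n ⟨r - 1, by omega⟩ with hm
  have hm1 : 1 < m := hn1 _
  have hnm : ∀ i, n i ∣ m := fun i => hdvd i _ (by rw [Fin.le_def]; simp; omega)
  obtain ⟨φ, hφ⟩ := exists_injective_pi_zmod n (by omega) hnm
  have hr' : (1 : ℝ) ≤ r := by exact_mod_cast hr
  have hl' : (1 : ℝ) ≤ l := by exact_mod_cast hl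
  have hrl : 1 ≤ (r : ℝ) * l := by nlinarith
  have hB : ∀ S : Multiset (∀ i, ZMod (n i)), IsZeroSumFree S →
      crossNumber S ≤ (r : ℝ) * l + ε / 2 := fun S hS => by
    rw [← crossNumber_map_of_injective hφ]
    exact hN m (by omega) hcard (le_of_max_le_left hmin) _ (hS.map_of_injective hφ)
  have hexp : ∀ g : ∀ i, ZMod (n i), m • g = 0 := by
    intro g
    ext i
    rw [Pi.smul_apply, nsmul_eq_mul, (ZMod.natCast_eq_zero_iff m (n i)).2 (hnm i), zero_mul]
    rfl
  have hmε : 2 / ε ≤ (m.minFac : ℝ) :=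
    (Nat.le_ceil _).trans (by exact_mod_cast le_of_max_le_right hmin)
  have h2ε : 0 < 2 / ε := by positivity
  refine ⟨?_, ?_, ?_⟩
  · refine Real.sSup_le ?_ (by linarith)
    rintro x ⟨S, hS, rfl⟩
    linarith [hB S hS]
  · refine Real.sSup_le ?_ (by linarith)
    rintro x ⟨S, hS, rfl⟩
    refine (hS.crossNumber_le (δ := ε / 2) (by linarith) hB (by linarith) fun g hg => ?_).trans
      (by linarith)
    have h1 : addOrderOf g ≠ 1 := by simpa using hg
    have h2 : m.minFac ≤ addOrderOf g :=
      (Nat.minFac_le_of_dvd (Nat.minFac_prime h1).two_le ((Nat.minFac_dvd _).trans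
        (addOrderOf_dvd_of_nsmul_eq_zero (hexp g)))).trans (Nat.minFac_le (Nat.pos_of_dvd_of_pos
          (addOrderOf_dvd_of_nsmul_eq_zero (hexp g)) (by omega)))
    have h3 : 2 / ε ≤ addOrderOf g := hmε.trans (by exact_mod_cast h2)
    calc (1 : ℝ) / addOrderOf g ≤ 1 / (2 / ε) := one_div_le_one_div_of_le h2ε h3
      _ = ε / 2 := one_div_div 2 ε
  · refine (davenport_le (m := m) (by omega) (by linarith) hexp hB).trans ?_
    have h1 : 2 / ε ≤ (m : ℝ) :=
      hmε.trans (by exact_mod_cast Nat.minFac_le (by omega))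
    rw [div_le_iff₀ hε] at h1
    nlinarith
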